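/- Let G be a nontrivial finite group and Y a (v,k,λ) pre-difference set in G. Then λ is an integer, and if k ≥ 2 then λ is a positive integer. -/

import Mathlib

open Finset

/-- The conjugacy class `[a]` of `a`, as a finset. -/
noncomputable def conjCl {G : Type} [Group G] [Fintype G] (a : G) : Finset G :=
  letI := Classical.decPred (IsConj a)
  Finset.univ.filter (fun b => IsConj a b)

/-- `λ_{[a]}(Y) = #{(x,y) ∈ Y×Y : x⁻¹y ∈ [a]}`. -/
noncomputable def lamConj {G : Type} [Group G] [Fintype G] (Y : Finset G) (a : G) : ℕ :=
  letI := Classical.decPred fun p : G × G => IsConj a (p.1⁻¹ * p.2)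
  ((Y ×ˢ Y).filter (fun p => IsConj a (p.1⁻¹ * p.2))).card

theorem mem_conjCl {G : Type} [Group G] [Fintype G] {a b : G} : b ∈ conjCl a ↔ IsConj a b := by
  simp [conjCl]

theorem coe_conjCl {G : Type} [Group G] [Fintype G] (a : G) :
    (conjCl a : Set G) = (ConjClasses.mk a).carrier := by
  ext b
  rw [mem_coe, mem_conjCl, ConjClasses.mem_carrier_iff_mk_eq, ConjClasses.mk_eq_mk_iff_isConj]
  exact isConj_comm

theorem card_conjCl_dvd_card {G : Type} [Group G] [Fintype G] (a : G) :
    (conjCl a).card ∣ Nat.card G := by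
  have h : Nat.card (MulAction.orbit (ConjAct G) a) = (conjCl a).card := by
    rw [ConjAct.orbit_eq_carrier_conjClasses, ← coe_conjCl]
    simp
  have hidx := MulAction.index_stabilizer (ConjAct G) a
  rw [← h, Nat.card_coe_set_eq, ← hidx]
  exact Subgroup.index_dvd_card _

/-- A number dividing the sizes of all nontrivial conjugacy classes divides `#G - 1`. -/
theorem dvd_card_sub_one_of_dvd_card_conjCl {G : Type} [Group G] [Fintype G] {d : ℕ}
    (h : ∀ a : G, a ≠ 1 → d ∣ (conjCl a).card) : d ∣ Nat.card G - 1 := by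
  classical
  have hcard : Nat.card G - 1 = (univ.erase (1 : G)).card := by simp
  rw [hcard, card_eq_sum_card_image (ConjClasses.mk : G → ConjClasses G)]
  refine dvd_sum fun c hc => ?_
  obtain ⟨a, ha, rfl⟩ := mem_image.mp hc
  have ha1 : a ≠ 1 := (mem_erase.mp ha).1
  suffices heq : {b ∈ univ.erase (1 : G) | ConjClasses.mk b = ConjClasses.mk a} = conjCl a by
    rw [heq]
    exact h a ha1
  ext b
  simp only [mem_filter, mem_erase, mem_univ, and_true, mem_conjCl,
    ConjClasses.mk_eq_mk_iff_isConj]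
  refine ⟨fun hb => hb.2.symm, fun hb => ⟨?_, hb.symm⟩⟩
  rintro rfl
  exact ha1 (isConj_one_left.mp hb)

theorem lamConj_pos {G : Type} [Group G] [Fintype G] {Y : Finset G} {x y : G}
    (hx : x ∈ Y) (hy : y ∈ Y) : 0 < lamConj Y (x⁻¹ * y) := by
  unfold lamConj
  refine card_pos.mpr ⟨(x, y), ?_⟩
  simp only [mem_filter]
  exact ⟨mk_mem_product hx hy, IsConj.refl _⟩

theorem Rat.den_dvd_of_mul_natCast_eq {q : ℚ} {m n : ℕ} (h : (m : ℚ) = q * n) :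
    q.den ∣ n := by
  have hq : (m : ℤ) * q.den = q.num * n := by
    have h' : (m : ℚ) * q.den = q.num * n := by
      rw [h, ← Rat.mul_den_eq_num q]
      ring
    exact_mod_cast h'
  have hdvd : (q.den : ℤ) ∣ q.num * n := ⟨m, by rw [← hq]; ring⟩
  have hcop : IsCoprime (q.den : ℤ) q.num := by
    rw [Int.isCoprime_iff_gcd_eq_one, Int.gcd_comm]
    exact q.reduced
  exact_mod_cast hcop.dvd_of_dvd_mul_left hdvd

theorem stmt14 {G : Type} [Group G] [Fintype G] [Nontrivial G]
    (Y : Finset G) (hY : Y.Nonempty) (lam : ℚ)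
    -- `Y` is a `(v, k, λ)` pre-difference set:
    (hpre : ∀ a : G, a ≠ 1 → (lamConj Y a : ℚ) = lam * ((conjCl a).card : ℚ)) :
    (∃ m : ℤ, lam = m) ∧ (2 ≤ Y.card → 0 < lam) := by
  constructor
  · have hden : ∀ a : G, a ≠ 1 → lam.den ∣ (conjCl a).card := fun a ha =>
      Rat.den_dvd_of_mul_natCast_eq (hpre a ha)
    obtain ⟨a, ha⟩ := exists_ne (1 : G)
    have h1 : lam.den ∣ Nat.card G := (hden a ha).trans (card_conjCl_dvd_card a)
    have h2 : lam.den ∣ Nat.card G - 1 := dvd_card_sub_one_of_dvd_card_conjCl hden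
    have h3 : lam.den ∣ 1 := by
      have h := Nat.dvd_sub h1 h2
      rwa [Nat.sub_sub_self Nat.card_pos] at h
    exact ⟨lam.num, (Rat.coe_int_num_of_den_eq_one (Nat.dvd_one.mp h3)).symm⟩
  · intro hk
    obtain ⟨x, hx, y, hy, hxy⟩ := one_lt_card.mp hk
    have h := hpre (x⁻¹ * y) fun h => hxy (inv_mul_eq_one.mp h)
    have hpos : (0 : ℚ) < lam * (conjCl (x⁻¹ * y)).card := by
      rw [← h]
      exact_mod_cast lamConj_pos hx hy
    exact pos_of_mul_pos_left hpos (Nat.cast_nonneg _)
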